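/- Fix p ∈ (0,1). For each n ≥ 2 let L_n ∈ ℕ with 0 ≤ L_n ≤ C(n,2) and suppose lim_{n→∞} L_n / C(n,2) = p. Let μ_mic^n be the uniform probability distribution on the (nonempty) set of simple graphs on Fin n with exactly L_n edges, and let μ_can^n be the Erdős–Rényi measure G(n, L_n/C(n,2)). Let E_mic^n[λ1] and E_can^n[λ1] denote the expectations of the largest adjacency eigenvalue λ1 under these two measures. Then lim_{n→∞} ( E_can^n[λ1] − E_mic^n[λ1] ) = 0. -/

import Mathlib

open scoped Classical
open Finset

/-- The real adjacency matrix of a simple graph on `Fin n`. -/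
noncomputable def adjMat {n : ℕ} (g : SimpleGraph (Fin n)) : Matrix (Fin n) (Fin n) ℝ :=
  g.adjMatrix ℝ

/-- The number of edges of a simple graph on `Fin n`. -/
noncomputable def edgeCount {n : ℕ} (g : SimpleGraph (Fin n)) : ℕ := g.edgeFinset.card

/-- The Erdős–Rényi `G(n,p)` probability of a single graph `g`:
`p ^ m (1-p) ^ (C(n,2) - m)` where `m` is the number of edges of `g`. -/
noncomputable def erWeight (n : ℕ) (p : ℝ) (g : SimpleGraph (Fin n)) : ℝ :=
  p ^ edgeCount g * (1 - p) ^ (n.choose 2 - edgeCount g)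

/-- The Erdős–Rényi `G(n,p)` expectation of a functional `f` of the graph. -/
noncomputable def erExp (n : ℕ) (p : ℝ) (f : SimpleGraph (Fin n) → ℝ) : ℝ :=
  ∑ g : SimpleGraph (Fin n), erWeight n p g * f g

/-- The largest eigenvalue of a real matrix, as the supremum of its spectrum. -/
noncomputable def lam1 {n : ℕ} (M : Matrix (Fin n) (Fin n) ℝ) : ℝ := sSup (spectrum ℝ M)

/-- The expectation of a functional `f` under the uniform distribution on a finite
set `Γ` of graphs (the microcanonical ensemble). -/
noncomputable def micExp {n : ℕ} (Γ : Finset (SimpleGraph (Fin n)))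
    (f : SimpleGraph (Fin n) → ℝ) : ℝ :=
  (∑ g ∈ Γ, f g) / (Γ.card : ℝ)

open Matrix in
theorem quadForm_le_lam1 {n : ℕ} {A : Matrix (Fin n) (Fin n) ℝ} (hA : A.IsSymm)
    (x : Fin n → ℝ) : x ⬝ᵥ A *ᵥ x ≤ lam1 A * (x ⬝ᵥ x) := by
  have hH : A.IsHermitian := by
    rw [Matrix.IsHermitian, Matrix.conjTranspose_eq_transpose_of_trivial]; exact hA
  have hfin : (spectrum ℝ A).Finite := by
    rw [hH.spectrum_real_eq_range_eigenvalues]; exact Set.finite_range _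
  have hpsd : (algebraMap ℝ (Matrix (Fin n) (Fin n) ℝ) (lam1 A) - A).PosSemidef := by
    rw [Matrix.posSemidef_iff_isHermitian_and_spectrum_nonneg]
    constructor
    · refine Matrix.IsHermitian.sub ?_ hH
      simp [Matrix.IsHermitian, Matrix.algebraMap_eq_diagonal]
    · intro z hz
      rw [← spectrum.singleton_sub_eq] at hz
      obtain ⟨a, ha, c, hc, rfl⟩ := Set.mem_sub.1 hz
      rw [Set.mem_singleton_iff] at ha
      subst ha
      exact sub_nonneg.2 (le_csSup hfin.bddAbove hc)
  have h := hpsd.dotProduct_mulVec_nonneg x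
  simp only [star_trivial, Matrix.sub_mulVec, Algebra.algebraMap_eq_smul_one, Matrix.smul_mulVec,
    Matrix.one_mulVec, dotProduct_sub, dotProduct_smul, smul_eq_mul] at h
  linarith

open Matrix in
theorem lam1_le {n : ℕ} (hn : 0 < n) {A : Matrix (Fin n) (Fin n) ℝ} (hA : A.IsSymm) {c : ℝ}
    (h : ∀ x : Fin n → ℝ, x ⬝ᵥ A *ᵥ x ≤ c * (x ⬝ᵥ x)) : lam1 A ≤ c := by
  have hH : A.IsHermitian := by
    rw [Matrix.IsHermitian, Matrix.conjTranspose_eq_transpose_of_trivial]; exact hA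
  have : Nonempty (Fin n) := ⟨⟨0, hn⟩⟩
  refine csSup_le ?_ ?_
  · rw [hH.spectrum_real_eq_range_eigenvalues]; exact Set.range_nonempty _
  · intro z hz
    rw [← Matrix.spectrum_toLin', ← Module.End.hasEigenvalue_iff_mem_spectrum] at hz
    obtain ⟨v, hv⟩ := hz.exists_hasEigenvector
    have h1 := hv.apply_eq_smul
    rw [Matrix.toLin'_apply] at h1
    have h2 := h v
    rw [h1, dotProduct_smul, smul_eq_mul] at h2
    have h3 : 0 < v ⬝ᵥ v := by
      have := dotProduct_star_self_pos_iff (v := v)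
      simpa using this.2 hv.2
    exact le_of_mul_le_mul_right h2 h3

open Matrix in
/-- The fourth power of the Schatten 4-norm of a symmetric matrix. -/
noncomputable def traceFour {n : ℕ} (H : Matrix (Fin n) (Fin n) ℝ) : ℝ :=
  ∑ i, ∑ j, ((H * H) i j) ^ 2

/-- The average of the row sums of a matrix. -/
noncomputable def rowMean {n : ℕ} (H : Matrix (Fin n) (Fin n) ℝ) : ℝ := (∑ i, ∑ j, H i j) / n

/-- The empirical variance of the row sums of a matrix. -/
noncomputable def rowVar {n : ℕ} (H : Matrix (Fin n) (Fin n) ℝ) : ℝ :=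
  (∑ i, (∑ j, H i j) ^ 2) / n - rowMean H ^ 2

open Matrix in
theorem mulVec_dotProduct_self_sq_le {n : ℕ} {H : Matrix (Fin n) (Fin n) ℝ} (hH : H.IsSymm)
    (x : Fin n → ℝ) : ((H *ᵥ x) ⬝ᵥ (H *ᵥ x)) ^ 2 ≤ traceFour H * (x ⬝ᵥ x) ^ 2 := by
  have h1 : (H *ᵥ x) ⬝ᵥ (H *ᵥ x) = ∑ p : Fin n × Fin n, (H * H) p.1 p.2 * (x p.1 * x p.2) := by
    have : (H *ᵥ x) ⬝ᵥ (H *ᵥ x) = x ⬝ᵥ (H * H) *ᵥ x := by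
      rw [← mulVec_mulVec, dotProduct_mulVec x, ← mulVec_transpose, hH.eq]
    rw [this, Fintype.sum_prod_type]
    simp only [dotProduct, mulVec, Finset.mul_sum]
    refine sum_congr rfl fun i _ => sum_congr rfl fun j _ => ?_
    ring
  rw [h1]
  refine (Finset.sum_mul_sq_le_sq_mul_sq _ _ _).trans (le_of_eq ?_)
  rw [Fintype.sum_prod_type, Fintype.sum_prod_type, traceFour]
  congr 1
  simp only [dotProduct, sq, Finset.sum_mul_sum]
  refine sum_congr rfl fun i _ => sum_congr rfl fun j _ => ?_
  ring

open Matrix in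
theorem mulVec_dotProduct_self_le {n : ℕ} {H : Matrix (Fin n) (Fin n) ℝ} (hH : H.IsSymm)
    {h : ℝ} (ht : traceFour H ≤ h ^ 4) (x : Fin n → ℝ) :
    (H *ᵥ x) ⬝ᵥ (H *ᵥ x) ≤ h ^ 2 * (x ⬝ᵥ x) := by
  have hx : 0 ≤ x ⬝ᵥ x := by simpa using dotProduct_star_self_nonneg x
  refine le_of_sq_le_sq ?_ (by positivity)
  refine (mulVec_dotProduct_self_sq_le hH x).trans ?_
  calc _ ≤ h ^ 4 * (x ⬝ᵥ x) ^ 2 := by gcongr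
    _ = _ := by ring

open Matrix in
theorem abs_dotProduct_mulVec_le {n : ℕ} {H : Matrix (Fin n) (Fin n) ℝ} (hH : H.IsSymm)
    {h : ℝ} (hh : 0 ≤ h) (ht : traceFour H ≤ h ^ 4) (x : Fin n → ℝ) :
    |x ⬝ᵥ H *ᵥ x| ≤ h * (x ⬝ᵥ x) := by
  have hx : 0 ≤ x ⬝ᵥ x := by simpa using dotProduct_star_self_nonneg x
  refine abs_le_of_sq_le_sq ?_ (by positivity)
  have hcs : (x ⬝ᵥ H *ᵥ x) ^ 2 ≤ (x ⬝ᵥ x) * ((H *ᵥ x) ⬝ᵥ (H *ᵥ x)) := by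
    have := Finset.sum_mul_sq_le_sq_mul_sq univ x (H *ᵥ x)
    simpa only [dotProduct, sq] using this
  refine hcs.trans ?_
  calc _ ≤ (x ⬝ᵥ x) * (h ^ 2 * (x ⬝ᵥ x)) := by
        gcongr; exact mulVec_dotProduct_self_le hH ht x
    _ = _ := by ring

open Matrix in
theorem rowMean_eq {n : ℕ} (H : Matrix (Fin n) (Fin n) ℝ) :
    rowMean H = (1 ⬝ᵥ H *ᵥ 1) / n := by
  simp [rowMean, dotProduct, mulVec]

open Matrix in
theorem rowVar_eq {n : ℕ} (H : Matrix (Fin n) (Fin n) ℝ) :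
    rowVar H = ((H *ᵥ 1) ⬝ᵥ (H *ᵥ 1)) / n - rowMean H ^ 2 := by
  simp [rowVar, dotProduct, mulVec, sq]

open Matrix in
theorem dotProduct_sub_rowMean_self {n : ℕ} (hn : 0 < n) (H : Matrix (Fin n) (Fin n) ℝ) :
    (H *ᵥ 1 - rowMean H • 1) ⬝ᵥ (H *ᵥ 1 - rowMean H • 1) = n * rowVar H := by
  have h1 : (1 : Fin n → ℝ) ⬝ᵥ H *ᵥ 1 = n * rowMean H := by
    rw [rowMean_eq]; field_simp
  have h2 : (H *ᵥ 1) ⬝ᵥ (H *ᵥ 1) = n * (rowVar H + rowMean H ^ 2) := by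
    rw [rowVar_eq]; field_simp; ring
  have h3 : (1 : Fin n → ℝ) ⬝ᵥ 1 = n := by simp [dotProduct]
  simp only [dotProduct_sub, sub_dotProduct, dotProduct_smul, smul_dotProduct, smul_eq_mul, h3,
    dotProduct_comm (H *ᵥ 1) 1, h1, h2]
  ring

theorem rowVar_nonneg {n : ℕ} (hn : 0 < n) (H : Matrix (Fin n) (Fin n) ℝ) : 0 ≤ rowVar H := by
  have h := dotProduct_sub_rowMean_self hn H
  have h0 : 0 ≤ (n : ℝ) * rowVar H := by
    have h1 := dotProduct_star_self_nonneg (H.mulVec 1 - rowMean H • 1)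
    rwa [star_trivial, h] at h1
  exact nonneg_of_mul_nonneg_right h0 (by exact_mod_cast hn)

open Matrix in
theorem dotProduct_rankOne_mulVec {n : ℕ} (H : Matrix (Fin n) (Fin n) ℝ) (q : ℝ)
    (x : Fin n → ℝ) :
    x ⬝ᵥ (H + q • vecMulVec 1 1) *ᵥ x = x ⬝ᵥ H *ᵥ x + q * (1 ⬝ᵥ x) ^ 2 := by
  simp only [add_mulVec, smul_mulVec, vecMulVec_mulVec, dotProduct_add, dotProduct_smul,
    smul_eq_mul, op_smul_eq_mul, dotProduct_comm x 1]
  ring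

open Matrix in
theorem isSymm_rankOne {n : ℕ} {H : Matrix (Fin n) (Fin n) ℝ} (hH : H.IsSymm) (q : ℝ) :
    (H + q • vecMulVec 1 1).IsSymm := by
  ext i j
  simp [hH.apply i j]

open Matrix in
theorem dotProduct_mulVec_smul_add {n : ℕ} {H : Matrix (Fin n) (Fin n) ℝ} (hH : H.IsSymm)
    (c : ℝ) (u v : Fin n → ℝ) :
    (c • v + u) ⬝ᵥ H *ᵥ (c • v + u)
      = c ^ 2 * (v ⬝ᵥ H *ᵥ v) + 2 * c * (u ⬝ᵥ H *ᵥ v) + u ⬝ᵥ H *ᵥ u := by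
  have h : v ⬝ᵥ H *ᵥ u = u ⬝ᵥ H *ᵥ v := by
    rw [dotProduct_mulVec, ← mulVec_transpose, hH.eq, dotProduct_comm]
  simp only [mulVec_add, mulVec_smul, dotProduct_add, add_dotProduct, dotProduct_smul,
    smul_dotProduct, smul_eq_mul, h]
  ring

open Matrix in
theorem rowMean_le_lam1 {n : ℕ} (hn : 0 < n) {H : Matrix (Fin n) (Fin n) ℝ} (hH : H.IsSymm)
    (q : ℝ) : q * n + rowMean H ≤ lam1 (H + q • vecMulVec 1 1) := by
  have h := quadForm_le_lam1 (isSymm_rankOne hH q) 1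
  have h3 : (1 : Fin n → ℝ) ⬝ᵥ 1 = n := by simp [dotProduct]
  have h1 : (1 : Fin n → ℝ) ⬝ᵥ H *ᵥ 1 = n * rowMean H := by
    rw [rowMean_eq]; field_simp
  rw [dotProduct_rankOne_mulVec, h3, h1] at h
  have hn' : (0 : ℝ) < n := by exact_mod_cast hn
  refine le_of_mul_le_mul_right ?_ hn'
  linarith

open Matrix in
/-- Second-order perturbation, upper bound. -/
theorem lam1_rankOne_le {n : ℕ} (hn : 0 < n) {H : Matrix (Fin n) (Fin n) ℝ} (hH : H.IsSymm)
    {h q : ℝ} (hh : 0 ≤ h) (ht : traceFour H ≤ h ^ 4) (hs : 2 * h < q * n) :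
    lam1 (H + q • vecMulVec 1 1)
      ≤ q * n + rowMean H + rowVar H / (q * n - 2 * h) := by
  have hn' : (0 : ℝ) < n := by exact_mod_cast hn
  have h3 : (1 : Fin n → ℝ) ⬝ᵥ 1 = n := by simp [dotProduct]
  have h1 : (1 : Fin n → ℝ) ⬝ᵥ H *ᵥ 1 = n * rowMean H := by
    rw [rowMean_eq]; field_simp
  have hρ : -h ≤ rowMean H := by
    have := (abs_le.1 (abs_dotProduct_mulVec_le hH hh ht 1)).1
    rw [h1, h3] at this
    nlinarith
  have hB := rowVar_nonneg hn H
  refine lam1_le hn (isSymm_rankOne hH q) fun x => ?_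
  set c : ℝ := (1 ⬝ᵥ x) / n with hc
  set u : Fin n → ℝ := x - c • 1 with hu
  have hx : x = c • 1 + u := by simp [hu]
  have h1u : (1 : Fin n → ℝ) ⬝ᵥ u = 0 := by
    rw [hu, dotProduct_sub, dotProduct_smul, h3, hc, smul_eq_mul]; field_simp; ring
  have h1x : 1 ⬝ᵥ x = n * c := by rw [hc]; field_simp
  set b : Fin n → ℝ := H *ᵥ 1 - rowMean H • 1 with hb
  have hbb : b ⬝ᵥ b = n * rowVar H := dotProduct_sub_rowMean_self hn H
  have hub : u ⬝ᵥ H *ᵥ 1 = u ⬝ᵥ b := by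
    rw [hb, dotProduct_sub, dotProduct_smul, dotProduct_comm u 1, h1u]; simp
  have hxx : x ⬝ᵥ x = n * c ^ 2 + u ⬝ᵥ u := by
    conv_lhs => rw [hx]
    simp only [dotProduct_add, add_dotProduct, dotProduct_smul, smul_dotProduct, h3, h1u,
      dotProduct_comm u 1, smul_eq_mul]
    ring
  have hq : x ⬝ᵥ H *ᵥ x = c ^ 2 * (n * rowMean H) + 2 * c * (u ⬝ᵥ b) + u ⬝ᵥ H *ᵥ u := by
    conv_lhs => rw [hx]
    rw [dotProduct_mulVec_smul_add hH, h1, hub]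
  rw [dotProduct_rankOne_mulVec, hq, h1x, hxx]
  have huHu := (abs_le.1 (abs_dotProduct_mulVec_le hH hh ht u)).2
  have huu : 0 ≤ u ⬝ᵥ u := by simpa using dotProduct_star_self_nonneg u
  set κ := q * n - 2 * h with hκ
  have hκ0 : 0 < κ := by linarith
  have hcross : 2 * c * (u ⬝ᵥ b) ≤ κ * (u ⬝ᵥ u) + c ^ 2 * (n * (rowVar H / κ)) := by
    have h0 : 0 ≤ (κ • u - c • b) ⬝ᵥ (κ • u - c • b) := by
      simpa using dotProduct_star_self_nonneg (κ • u - c • b)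
    simp only [dotProduct_sub, sub_dotProduct, dotProduct_smul, smul_dotProduct, smul_eq_mul,
      dotProduct_comm b u, hbb] at h0
    have h5 : κ * (κ * (u ⬝ᵥ u) + c ^ 2 * (n * (rowVar H / κ)) - 2 * c * (u ⬝ᵥ b))
      = κ * (κ * u ⬝ᵥ u - c * u ⬝ᵥ b) - c * (κ * u ⬝ᵥ b - c * (n * rowVar H)) := by
      field_simp; ring
    rw [← h5] at h0
    linarith [nonneg_of_mul_nonneg_right h0 hκ0]
  have hδ : 0 ≤ rowVar H / κ := by positivity
  nlinarith [mul_nonneg hδ huu, mul_nonneg (show 0 ≤ rowMean H + h by linarith) huu]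

open Matrix in
theorem le_lam1_rankOne {n : ℕ} (hn : 0 < n) {H : Matrix (Fin n) (Fin n) ℝ} (hH : H.IsSymm)
    {h q : ℝ} (hh : 0 ≤ h) (ht : traceFour H ≤ h ^ 4) (hs : 0 < q * n) :
    q * n + rowMean H + 2 * (rowVar H / (q * n)) - h * (rowVar H / (q * n) ^ 2)
      ≤ lam1 (H + q • vecMulVec 1 1) * (1 + rowVar H / (q * n) ^ 2) := by
  have hn' : (0 : ℝ) < n := by exact_mod_cast hn
  have h3 : (1 : Fin n → ℝ) ⬝ᵥ 1 = n := by simp [dotProduct]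
  have h1 : (1 : Fin n → ℝ) ⬝ᵥ H *ᵥ 1 = n * rowMean H := by
    rw [rowMean_eq]; field_simp
  set s := q * n with hs_def
  set b : Fin n → ℝ := H *ᵥ 1 - rowMean H • 1 with hb
  have hbb : b ⬝ᵥ b = n * rowVar H := dotProduct_sub_rowMean_self hn H
  have hb1 : (1 : Fin n → ℝ) ⬝ᵥ b = 0 := by
    rw [hb, dotProduct_sub, dotProduct_smul, h1, h3, smul_eq_mul]; ring
  have hbH : b ⬝ᵥ H *ᵥ 1 = n * rowVar H := by
    have : H *ᵥ 1 = b + rowMean H • 1 := by simp [hb]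
    rw [this, dotProduct_add, dotProduct_smul, dotProduct_comm b 1, hb1, hbb]; simp
  have hR := quadForm_le_lam1 (isSymm_rankOne hH q) ((1 : ℝ) • 1 + s⁻¹ • b)
  rw [dotProduct_rankOne_mulVec, dotProduct_mulVec_smul_add hH, h1] at hR
  simp only [mulVec_smul, dotProduct_add, add_dotProduct, dotProduct_smul, smul_dotProduct, h3,
    hb1, hbb, hbH, dotProduct_comm b 1, smul_eq_mul] at hR
  have hbHb := (abs_le.1 (abs_dotProduct_mulVec_le hH hh ht b)).1
  rw [hbb] at hbHb
  have h4 : s⁻¹ ^ 2 * -(h * (n * rowVar H)) ≤ s⁻¹ ^ 2 * (b ⬝ᵥ H *ᵥ b) := by gcongr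
  refine le_of_mul_le_mul_left ?_ hn'
  have e1 : rowVar H / s = s⁻¹ * rowVar H := by ring
  have e2 : rowVar H / s ^ 2 = s⁻¹ ^ 2 * rowVar H := by ring
  rw [e1, e2]
  have e3 : (n : ℝ) * s = q * n ^ 2 := by rw [hs_def]; ring
  nlinarith

open Matrix in
theorem rowVar_le_of_traceFour {n : ℕ} (hn : 0 < n) {H : Matrix (Fin n) (Fin n) ℝ}
    (hH : H.IsSymm) {h : ℝ} (ht : traceFour H ≤ h ^ 4) : rowVar H ≤ h ^ 2 := by
  have hn' : (0 : ℝ) < n := by exact_mod_cast hn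
  have h1 := mulVec_dotProduct_self_le hH ht 1
  have h3 : (1 : Fin n → ℝ) ⬝ᵥ 1 = n := by simp [dotProduct]
  rw [h3] at h1
  rw [rowVar_eq]
  have : (H *ᵥ 1) ⬝ᵥ (H *ᵥ 1) / n ≤ h ^ 2 := by rwa [div_le_iff₀ hn']
  nlinarith [sq_nonneg (rowMean H)]

open Matrix in
theorem abs_lam1_rankOne_sub_le {n : ℕ} (hn : 0 < n) {H : Matrix (Fin n) (Fin n) ℝ}
    (hH : H.IsSymm) {η q : ℝ} (hη : 0 < η) (hη4 : η ≤ 1 / 4) (hq : 0 < q)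
    (ht : traceFour H ≤ (η * (q * n)) ^ 4) :
    |lam1 (H + q • vecMulVec 1 1) - (q * n + rowMean H) - rowVar H / (q * n)|
      ≤ 4 * η * (rowVar H / (q * n)) := by
  have hn' : (0 : ℝ) < n := by exact_mod_cast hn
  have h3 : (1 : Fin n → ℝ) ⬝ᵥ 1 = n := by simp [dotProduct]
  have h1 : (1 : Fin n → ℝ) ⬝ᵥ H *ᵥ 1 = n * rowMean H := by
    rw [rowMean_eq]; field_simp
  set s := q * n with hs_def
  have hs : 0 < s := by positivity
  have hh : 0 ≤ η * s := by positivity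
  have hup := lam1_rankOne_le hn hH hh ht (q := q) (by rw [← hs_def]; nlinarith)
  have hlo := le_lam1_rankOne hn hH hh ht (q := q) (by rw [← hs_def]; exact hs)
  have hBh := rowVar_le_of_traceFour hn hH ht
  have hB := rowVar_nonneg hn H
  have hρ : rowMean H ≤ η * s := by
    have := (abs_le.1 (abs_dotProduct_mulVec_le hH hh ht 1)).2
    rw [h1, h3] at this
    nlinarith
  rw [← hs_def] at hup hlo
  set lam := lam1 (H + q • vecMulVec 1 1)
  set B := rowVar H
  set ρ := rowMean H
  set t := B / s with ht_def
  have ht0 : 0 ≤ t := by positivity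
  have hBt : B = t * s := by rw [ht_def]; field_simp
  have e1 : B / s ^ 2 = t / s := by rw [ht_def]; field_simp
  have hts : t / s ≤ η ^ 2 := by
    rw [← e1, div_le_iff₀ (by positivity)]; nlinarith
  have hts0 : 0 ≤ t / s := by positivity
  have e2 : B / (s - 2 * (η * s)) = t / (1 - 2 * η) := by
    have : (1 - 2 * η) ≠ 0 := by linarith
    have h' : s - 2 * (η * s) = s * (1 - 2 * η) := by ring
    rw [h', ht_def]; field_simp
  have e3 : t / (1 - 2 * η) ≤ t + 4 * η * t := by
    rw [div_le_iff₀ (by linarith)]; nlinarith [mul_nonneg ht0 hη.le]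
  rw [e2] at hup
  rw [e1] at hlo
  rw [abs_le]
  constructor
  · have h5 : η * s * (t / s) = η * t := by field_simp
    have h6 : s * (t / s) = t := by field_simp
    rw [h5] at hlo
    -- the gain over the mean, scaled by the normalisation of the test vector
    have h7 : t * (1 - 2 * η) ≤ (lam - s - ρ) * (1 + t / s) := by
      nlinarith [mul_le_mul_of_nonneg_right hρ hts0]
    by_contra hcon
    have h8 : lam - s - ρ < t * (1 - 4 * η) := by linarith
    have h9 : (lam - s - ρ) * (1 + t / s) < t * (1 - 4 * η) * (1 + t / s) :=
      mul_lt_mul_of_pos_right h8 (by linarith)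
    have h10 : t * (1 - 4 * η) * (1 + t / s) ≤ t * (1 - 4 * η) * (1 + η ^ 2) :=
      mul_le_mul_of_nonneg_left (by linarith) (mul_nonneg ht0 (by linarith))
    have h11 : (1 - 4 * η) * (1 + η ^ 2) ≤ 1 - 2 * η := by nlinarith [pow_pos hη 3]
    nlinarith [mul_le_mul_of_nonneg_left h11 ht0]
  · linarith

/-- The indicator of an edge of a graph, centred at `q`. -/
noncomputable def centredEntry {n : ℕ} (q : ℝ) (g : SimpleGraph (Fin n)) (e : Sym2 (Fin n)) : ℝ :=
  (if e ∈ g.edgeSet then 1 else 0) - q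

/-- The adjacency matrix of a graph with all entries, including the diagonal ones, shifted by
`-q`. -/
noncomputable def centredMat {n : ℕ} (q : ℝ) (g : SimpleGraph (Fin n)) :
    Matrix (Fin n) (Fin n) ℝ :=
  Matrix.of fun i j => centredEntry q g s(i, j)

theorem centredMat_apply {n : ℕ} (q : ℝ) (g : SimpleGraph (Fin n)) (i j : Fin n) :
    centredMat q g i j = centredEntry q g s(i, j) := rfl

theorem centredMat_isSymm {n : ℕ} (q : ℝ) (g : SimpleGraph (Fin n)) : (centredMat q g).IsSymm := by
  ext i j
  simp [centredMat_apply, Sym2.eq_swap]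

theorem adjMat_eq_centredMat_add {n : ℕ} (q : ℝ) (g : SimpleGraph (Fin n)) :
    adjMat g = centredMat q g + q • Matrix.vecMulVec 1 1 := by
  ext i j
  simp [adjMat, centredMat_apply, centredEntry, SimpleGraph.adjMatrix_apply]

theorem abs_centredEntry_le {n : ℕ} {q : ℝ} (hq0 : 0 ≤ q) (hq1 : q ≤ 1)
    (g : SimpleGraph (Fin n)) (e : Sym2 (Fin n)) : |centredEntry q g e| ≤ 1 := by
  unfold centredEntry
  split_ifs <;> rw [abs_le] <;> constructor <;> linarith

theorem centredEntry_of_isDiag {n : ℕ} (q : ℝ) (g : SimpleGraph (Fin n)) {e : Sym2 (Fin n)}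
    (he : e.IsDiag) : centredEntry q g e = -q := by
  have : e ∉ g.edgeSet := fun h => g.not_isDiag_of_mem_edgeSet h he
  simp [centredEntry, this]

theorem centredEntry_sq {n : ℕ} (q : ℝ) (g : SimpleGraph (Fin n)) (e : Sym2 (Fin n)) :
    centredEntry q g e * centredEntry q g e
      = q * (1 - q) + (1 - 2 * q) * centredEntry q g e := by
  unfold centredEntry
  split_ifs <;> ring

theorem rowVar_centredMat_le {n : ℕ} (hn : 0 < n) {q : ℝ} (hq0 : 0 ≤ q) (hq1 : q ≤ 1)
    (g : SimpleGraph (Fin n)) : rowVar (centredMat q g) ≤ (n : ℝ) ^ 2 := by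
  have hn' : (0 : ℝ) < n := by exact_mod_cast hn
  have hrow : ∀ i, (∑ j, centredMat q g i j) ^ 2 ≤ (n : ℝ) ^ 2 := fun i => by
    rw [← sq_abs]
    gcongr
    refine (abs_sum_le_sum_abs _ _).trans ?_
    refine (sum_le_sum fun j _ => abs_centredEntry_le hq0 hq1 g s(i, j)).trans ?_
    simp
  have h1 : (∑ i, (∑ j, centredMat q g i j) ^ 2) ≤ n * (n : ℝ) ^ 2 :=
    (sum_le_sum fun i _ => hrow i).trans (by simp)
  have h2 : (∑ i, (∑ j, centredMat q g i j) ^ 2) / n ≤ (n : ℝ) ^ 2 := by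
    rw [div_le_iff₀ hn']; linarith
  unfold rowVar
  linarith [sq_nonneg (rowMean (centredMat q g))]

open Matrix in
theorem lam1_adjMat_le {n : ℕ} (hn : 0 < n) (g : SimpleGraph (Fin n)) : lam1 (adjMat g) ≤ n := by
  refine lam1_le hn (SimpleGraph.isSymm_adjMatrix g) fun x => ?_
  have h1 : x ⬝ᵥ adjMat g *ᵥ x ≤ ∑ i, ∑ j, (x i ^ 2 + x j ^ 2) / 2 := by
    simp only [dotProduct, mulVec, Finset.mul_sum]
    refine sum_le_sum fun i _ => sum_le_sum fun j _ => ?_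
    simp only [adjMat, SimpleGraph.adjMatrix_apply]
    split_ifs
    · nlinarith [sq_nonneg (x i - x j)]
    · nlinarith [sq_nonneg (x i), sq_nonneg (x j)]
  refine h1.trans (le_of_eq ?_)
  have h2 : x ⬝ᵥ x = ∑ i, x i ^ 2 := by simp [dotProduct, sq]
  simp only [← Finset.sum_div, sum_add_distrib, sum_const, card_univ, Fintype.card_fin,
    nsmul_eq_mul, ← Finset.mul_sum, h2]
  ring

theorem mean_degree_nonneg {n : ℕ} (hn : 0 < n) (q : ℝ) (g : SimpleGraph (Fin n)) :
    0 ≤ q * n + rowMean (centredMat q g) := by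
  have hn' : (0 : ℝ) < n := by exact_mod_cast hn
  have : q * n + rowMean (centredMat q g)
      = (∑ i : Fin n, ∑ j : Fin n, (if s(i, j) ∈ g.edgeSet then (1 : ℝ) else 0)) / n := by
    simp only [rowMean, centredMat_apply, centredEntry, sum_sub_distrib, sum_const, card_univ,
      Fintype.card_fin, nsmul_eq_mul]
    field_simp
    ring
  rw [this]
  refine div_nonneg (sum_nonneg fun i _ => sum_nonneg fun j _ => ?_) hn'.le
  split_ifs <;> norm_num

/-- Pointwise second-order expansion of the largest eigenvalue. -/
theorem abs_lam1_adjMat_sub_le {n : ℕ} (hn : 0 < n) {q η : ℝ} (hq0 : 0 < q) (hq1 : q ≤ 1)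
    (hη : 0 < η) (hη4 : η ≤ 1 / 4) (g : SimpleGraph (Fin n)) :
    |lam1 (adjMat g) - (q * n + rowMean (centredMat q g)) - rowVar (centredMat q g) / (q * n)|
      ≤ 4 * η * (rowVar (centredMat q g) / (q * n))
        + (n + n ^ 2 / (q * n)) * (traceFour (centredMat q g) ^ 2 / (η * (q * n)) ^ 8) := by
  have hn' : (0 : ℝ) < n := by exact_mod_cast hn
  have hB := rowVar_nonneg hn (centredMat q g)
  by_cases ht : traceFour (centredMat q g) ≤ (η * (q * n)) ^ 4
  · have h := abs_lam1_rankOne_sub_le hn (centredMat_isSymm q g) hη hη4 hq0 ht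
    rw [← adjMat_eq_centredMat_add] at h
    have : 0 ≤ (n + n ^ 2 / (q * n)) * (traceFour (centredMat q g) ^ 2 / (η * (q * n)) ^ 8) := by
      positivity
    linarith
  · have hratio : 1 ≤ traceFour (centredMat q g) ^ 2 / (η * (q * n)) ^ 8 := by
      rw [one_le_div (by positivity)]
      calc (η * (q * n)) ^ 8 = ((η * (q * n)) ^ 4) ^ 2 := by ring
        _ ≤ _ := by gcongr; exact (not_le.1 ht).le
    have h1 := lam1_adjMat_le hn g
    have h2 := rowMean_le_lam1 hn (centredMat_isSymm q g) q
    rw [← adjMat_eq_centredMat_add] at h2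
    have h3 := mean_degree_nonneg hn q g
    have h4 : rowVar (centredMat q g) / (q * n) ≤ n ^ 2 / (q * n) := by
      gcongr; exact rowVar_centredMat_le hn hq0.le hq1 g
    have h5 : 0 ≤ rowVar (centredMat q g) / (q * n) := by positivity
    have h6 : (0 : ℝ) ≤ n + n ^ 2 / (q * n) := by positivity
    have h7 := mul_le_mul_of_nonneg_left hratio h6
    have h8 : 0 ≤ 4 * η * (rowVar (centredMat q g) / (q * n)) := by positivity
    rw [abs_le]
    constructor <;> linarith

/-- The product of the entries of a symmetric edge function along a closed walk of length four. -/
def cycleProd {n : ℕ} (Y : Sym2 (Fin n) → ℝ) (t : Fin 4 → Fin n) : ℝ :=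
  ∏ c, Y s(t c, t (c + 1))

theorem traceFour_eq_sum_cycleProd {n : ℕ} (q : ℝ) (g : SimpleGraph (Fin n)) :
    traceFour (centredMat q g) = ∑ t, cycleProd (centredEntry q g) t := by
  have e : (∑ t : Fin 4 → Fin n, cycleProd (centredEntry q g) t)
      = ∑ x : Fin n × Fin n × Fin n × Fin n,
          cycleProd (centredEntry q g) ![x.1, x.2.2.1, x.2.1, x.2.2.2] := by
    refine Fintype.sum_equiv
      { toFun := fun t => (t 0, t 2, t 1, t 3)
        invFun := fun x => ![x.1, x.2.2.1, x.2.1, x.2.2.2]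
        left_inv := fun t => by ext i; fin_cases i <;> rfl
        right_inv := fun x => rfl } _ _ fun t => ?_
    congr 1
    ext i; fin_cases i <;> rfl
  rw [e]
  simp only [Fintype.sum_prod_type, traceFour, Matrix.mul_apply, sq, Finset.sum_mul_sum]
  refine sum_congr rfl fun i _ => sum_congr rfl fun j _ => sum_congr rfl fun k _ =>
    sum_congr rfl fun l _ => ?_
  simp only [cycleProd, Fin.prod_univ_four, centredMat_apply]
  change _ = centredEntry q g s(i, k) * centredEntry q g s(k, j) * centredEntry q g s(j, l)
    * centredEntry q g s(l, i)
  rw [Sym2.eq_swap (a := i) (b := l), Sym2.eq_swap (a := l) (b := j)]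
  ring

theorem abs_cycleProd_le {n : ℕ} {q : ℝ} (hq0 : 0 ≤ q) (hq1 : q ≤ 1)
    (g : SimpleGraph (Fin n)) (t : Fin 4 → Fin n) : |cycleProd (centredEntry q g) t| ≤ 1 := by
  rw [cycleProd, abs_prod]
  exact prod_le_one (fun _ _ => abs_nonneg _) fun _ _ => abs_centredEntry_le hq0 hq1 g _

theorem card_le_pow_of_determined {ι : Type*} [Fintype ι] {n : ℕ} (D : Finset ι)
    (Q : Finset (ι → Fin n))
    (h : ∀ s ∈ Q, ∀ t ∈ Q, (∀ i, i ∉ D → s i = t i) → s = t) :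
    Q.card ≤ n ^ (Fintype.card ι - D.card) := by
  have h1 : Q.card ≤ (univ : Finset ({i // i ∉ D} → Fin n)).card := by
    refine card_le_card_of_injOn (fun s i => s i.1) (fun _ _ => mem_coe.2 (mem_univ _)) ?_
    intro s hs t ht hst
    exact h s hs t ht fun i hi => congrFun hst ⟨i, hi⟩
  refine h1.trans (le_of_eq ?_)
  rw [card_univ, Fintype.card_fun, Fintype.card_fin, Fintype.card_subtype_compl]
  simp

theorem card_not_injective_le (n : ℕ) :
    (univ.filter fun t : Fin 4 → Fin n => ¬ Function.Injective t).card ≤ 16 * n ^ 3 := by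
  have hsub : (univ.filter fun t : Fin 4 → Fin n => ¬ Function.Injective t)
      ⊆ (univ : Finset (Fin 4 × Fin 4)).biUnion fun p =>
        univ.filter fun t : Fin 4 → Fin n => p.1 ≠ p.2 ∧ t p.1 = t p.2 := by
    intro t ht
    simp only [mem_filter, mem_univ, true_and, Function.Injective, not_forall] at ht
    obtain ⟨a, b, hab, hne⟩ := ht
    simp only [mem_biUnion, mem_filter, mem_univ, true_and]
    exact ⟨(a, b), hne, hab⟩
  refine (card_le_card hsub).trans ((card_biUnion_le_card_mul _ _ (n ^ 3) fun p _ => ?_).trans ?_)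
  · refine (card_le_pow_of_determined {p.1} _ ?_).trans (by simp)
    intro s hs t ht hst
    simp only [mem_filter, mem_univ, true_and] at hs ht
    ext i
    by_cases hi : i = p.1
    · rw [hi, hs.2, ht.2, hst p.2 (by simpa using hs.1.symm)]
    · rw [hst i (by simpa using hi)]
  · simp

theorem card_edge_eq_le {n : ℕ} (d : Fin 4) (e : Sym2 (Fin n)) :
    (univ.filter fun t : Fin 4 → Fin n => e = s(t d, t (d + 1))).card ≤ 2 * n ^ 2 := by
  induction e with | _ a b => ?_
  have hd : d ≠ d + 1 := by fin_cases d <;> decide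
  have key : ∀ x y : Fin n,
      (univ.filter fun t : Fin 4 → Fin n => t d = x ∧ t (d + 1) = y).card ≤ n ^ 2 := by
    intro x y
    refine (card_le_pow_of_determined {d, d + 1} _ ?_).trans (by rw [card_pair hd]; simp)
    intro s hs t ht hst
    simp only [mem_filter, mem_univ, true_and] at hs ht
    ext i
    by_cases hi : i = d
    · rw [hi, hs.1, ht.1]
    · by_cases hi' : i = d + 1
      · rw [hi', hs.2, ht.2]
      · rw [hst i (by simp [hi, hi'])]
  have hsub : (univ.filter fun t : Fin 4 → Fin n => s(a, b) = s(t d, t (d + 1)))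
      ⊆ (univ.filter fun t : Fin 4 → Fin n => t d = a ∧ t (d + 1) = b) ∪
        (univ.filter fun t : Fin 4 → Fin n => t d = b ∧ t (d + 1) = a) := by
    intro t ht
    simp only [mem_filter, mem_univ, true_and, Sym2.eq_iff, mem_union] at ht ⊢
    tauto
  calc _ ≤ _ := card_le_card hsub
    _ ≤ _ := card_union_le _ _
    _ ≤ 2 * n ^ 2 := by linarith [key a b, key b a]

/-- The contribution to `traceFour` of genuine four-cycles. -/
noncomputable def cycleSum {n : ℕ} (Y : Sym2 (Fin n) → ℝ) : ℝ :=
  ∑ t ∈ univ.filter fun t : Fin 4 → Fin n => Function.Injective t, cycleProd Y t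

theorem traceFour_sq_le {n : ℕ} {q : ℝ} (hq0 : 0 ≤ q) (hq1 : q ≤ 1)
    (g : SimpleGraph (Fin n)) :
    traceFour (centredMat q g) ^ 2 ≤ 512 * n ^ 6 + 2 * cycleSum (centredEntry q g) ^ 2 := by
  rw [traceFour_eq_sum_cycleProd,
    ← sum_filter_add_sum_filter_not univ fun t : Fin 4 → Fin n => Function.Injective t]
  change (cycleSum (centredEntry q g) + _) ^ 2 ≤ _
  set R := ∑ t ∈ univ.filter fun t : Fin 4 → Fin n => ¬ Function.Injective t,
    cycleProd (centredEntry q g) t with hR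
  have hRle : |R| ≤ 16 * n ^ 3 := by
    refine (abs_sum_le_sum_abs _ _).trans ?_
    refine (sum_le_sum fun t _ => abs_cycleProd_le hq0 hq1 g t).trans ?_
    rw [sum_const, nsmul_eq_mul, mul_one]
    exact_mod_cast card_not_injective_le n
  have hR2 : R ^ 2 ≤ (16 * n ^ 3) ^ 2 := by
    rw [← sq_abs]; gcongr
  nlinarith [sq_nonneg (cycleSum (centredEntry q g) - R)]

theorem injective_cycle_edge {n : ℕ} {t : Fin 4 → Fin n} (ht : Function.Injective t) :
    Function.Injective fun c => s(t c, t (c + 1)) := by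
  intro c d h
  simp only [Sym2.eq_iff] at h
  rcases h with h | h
  · exact ht h.1
  · have h1 := ht h.1
    have h2 := ht h.2
    clear h ht
    revert c d
    decide

theorem not_isDiag_cycle_edge {n : ℕ} {t : Fin 4 → Fin n} (ht : Function.Injective t)
    (c : Fin 4) : ¬ (s(t c, t (c + 1))).IsDiag := by
  rw [Sym2.mk_isDiag_iff]
  intro h
  have := ht h
  revert this
  fin_cases c <;> decide

/-- The expectation of `f` under the weight `w` on graphs. -/
noncomputable def weightExp {n : ℕ} (w f : SimpleGraph (Fin n) → ℝ) : ℝ := ∑ g, w g * f g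

/-- A probability weight on graphs under which the edge indicators have mean `q` and the products
of `2` to `8` distinct centred edge indicators have mean at most `δ` in absolute value. -/
structure IsNearlyIndependent {n : ℕ} (w : SimpleGraph (Fin n) → ℝ) (q δ : ℝ) : Prop where
  nonneg : ∀ g, 0 ≤ w g
  sum_eq_one : ∑ g, w g = 1
  mean_eq_zero : ∀ e : Sym2 (Fin n), ¬ e.IsDiag → weightExp w (fun g => centredEntry q g e) = 0
  abs_prod_le : ∀ S : Finset (Sym2 (Fin n)), (∀ e ∈ S, ¬ e.IsDiag) → 2 ≤ S.card → S.card ≤ 8 →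
    |weightExp w (fun g => ∏ e ∈ S, centredEntry q g e)| ≤ δ

section weightExp

variable {n : ℕ} {w : SimpleGraph (Fin n) → ℝ}

theorem weightExp_add (f₁ f₂ : SimpleGraph (Fin n) → ℝ) :
    weightExp w (fun g => f₁ g + f₂ g) = weightExp w f₁ + weightExp w f₂ := by
  simp [weightExp, mul_add, sum_add_distrib]

theorem weightExp_sub (f₁ f₂ : SimpleGraph (Fin n) → ℝ) :
    weightExp w (fun g => f₁ g - f₂ g) = weightExp w f₁ - weightExp w f₂ := by
  simp [weightExp, mul_sub, sum_sub_distrib]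

theorem weightExp_const_mul (c : ℝ) (f : SimpleGraph (Fin n) → ℝ) :
    weightExp w (fun g => c * f g) = c * weightExp w f := by
  simp only [weightExp, Finset.mul_sum]
  exact sum_congr rfl fun g _ => by ring

theorem weightExp_div (f : SimpleGraph (Fin n) → ℝ) (c : ℝ) :
    weightExp w (fun g => f g / c) = weightExp w f / c := by
  simp only [weightExp, Finset.sum_div, mul_div_assoc]

theorem weightExp_sum {ι : Type*} (s : Finset ι) (f : ι → SimpleGraph (Fin n) → ℝ) :
    weightExp w (fun g => ∑ i ∈ s, f i g) = ∑ i ∈ s, weightExp w (f i) := by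
  simp only [weightExp, Finset.mul_sum]
  exact sum_comm

variable {q δ : ℝ}

theorem weightExp_const (hw : IsNearlyIndependent w q δ)
    (c : ℝ) : weightExp w (fun _ => c) = c := by
  rw [weightExp, ← Finset.sum_mul, hw.sum_eq_one, one_mul]

theorem weightExp_mono (hw : IsNearlyIndependent w q δ)
    {f₁ f₂ : SimpleGraph (Fin n) → ℝ} (h : ∀ g, f₁ g ≤ f₂ g) :
    weightExp w f₁ ≤ weightExp w f₂ :=
  sum_le_sum fun g _ => mul_le_mul_of_nonneg_left (h g) (hw.nonneg g)

theorem abs_weightExp_le (hw : IsNearlyIndependent w q δ) (f : SimpleGraph (Fin n) → ℝ) :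
    |weightExp w f| ≤ weightExp w (fun g => |f g|) := by
  refine (abs_sum_le_sum_abs _ _).trans (le_of_eq ?_)
  exact sum_congr rfl fun g _ => by rw [abs_mul, abs_of_nonneg (hw.nonneg g)]

theorem weightExp_cycleProd_mul_le (hw : IsNearlyIndependent w q δ)
    (hδ : 0 ≤ δ) (hq0 : 0 ≤ q) (hq1 : q ≤ 1)
    {t t' : Fin 4 → Fin n} (ht : Function.Injective t) (ht' : Function.Injective t') :
    weightExp w (fun g => cycleProd (centredEntry q g) t * cycleProd (centredEntry q g) t')
      ≤ δ + ∑ c : Fin 4, ∑ d : Fin 4,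
        if s(t c, t (c + 1)) = s(t' d, t' (d + 1)) then (1 : ℝ) else 0 := by
  by_cases hcd : ∃ c d, s(t c, t (c + 1)) = s(t' d, t' (d + 1))
  · obtain ⟨c, d, h⟩ := hcd
    have h1 : weightExp w
        (fun g => cycleProd (centredEntry q g) t * cycleProd (centredEntry q g) t') ≤ 1 := by
      rw [← weightExp_const hw 1]
      refine weightExp_mono hw fun g => (le_abs_self _).trans ?_
      rw [abs_mul]
      exact mul_le_one₀ (abs_cycleProd_le hq0 hq1 g t) (abs_nonneg _) (abs_cycleProd_le hq0 hq1 g t')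
    have hnn : ∀ c d : Fin 4,
        0 ≤ if s(t c, t (c + 1)) = s(t' d, t' (d + 1)) then (1 : ℝ) else 0 := fun c d => by
      split_ifs <;> norm_num
    have h2 : (1 : ℝ) ≤ ∑ c : Fin 4, ∑ d : Fin 4,
        if s(t c, t (c + 1)) = s(t' d, t' (d + 1)) then (1 : ℝ) else 0 := by
      calc (1 : ℝ) = if s(t c, t (c + 1)) = s(t' d, t' (d + 1)) then (1 : ℝ) else 0 := by
            rw [if_pos h]
        _ ≤ ∑ d : Fin 4, if s(t c, t (c + 1)) = s(t' d, t' (d + 1)) then (1 : ℝ) else 0 :=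
            single_le_sum (f := fun d => if s(t c, t (c + 1)) = s(t' d, t' (d + 1)) then (1 : ℝ)
              else 0) (fun d _ => hnn c d) (mem_univ d)
        _ ≤ _ := single_le_sum (f := fun c => ∑ d : Fin 4,
            if s(t c, t (c + 1)) = s(t' d, t' (d + 1)) then (1 : ℝ) else 0)
            (fun c _ => sum_nonneg fun d _ => hnn c d) (mem_univ c)
    linarith
  · push Not at hcd
    have h0 : (∑ c : Fin 4, ∑ d : Fin 4,
        if s(t c, t (c + 1)) = s(t' d, t' (d + 1)) then (1 : ℝ) else 0) = 0 :=
      sum_eq_zero fun c _ => sum_eq_zero fun d _ => if_neg (hcd c d)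
    rw [h0, add_zero]
    set S := univ.image fun c => s(t c, t (c + 1)) with hS
    set S' := univ.image fun c => s(t' c, t' (c + 1)) with hS'
    have hdisj : Disjoint S S' := by
      rw [Finset.disjoint_left]
      intro e he he'
      simp only [hS, hS', mem_image, mem_univ, true_and] at he he'
      obtain ⟨c, rfl⟩ := he
      obtain ⟨d, hd⟩ := he'
      exact hcd c d hd.symm
    have hcard : (S ∪ S').card = 8 := by
      rw [card_union_of_disjoint hdisj, hS, hS', card_image_of_injective _ (injective_cycle_edge ht),
        card_image_of_injective _ (injective_cycle_edge ht')]
      simp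
    have hprod : ∀ g : SimpleGraph (Fin n),
        cycleProd (centredEntry q g) t * cycleProd (centredEntry q g) t'
          = ∏ e ∈ S ∪ S', centredEntry q g e := fun g => by
      rw [prod_union hdisj, hS, hS', prod_image fun a _ b _ h => injective_cycle_edge ht h,
        prod_image fun a _ b _ h => injective_cycle_edge ht' h]
      rfl
    simp only [hprod]
    refine (le_abs_self _).trans (hw.abs_prod_le _ ?_ (by omega) (by omega))
    intro e he
    simp only [hS, hS', mem_union, mem_image, mem_univ, true_and] at he
    rcases he with ⟨c, rfl⟩ | ⟨c, rfl⟩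
    · exact not_isDiag_cycle_edge ht c
    · exact not_isDiag_cycle_edge ht' c

theorem weightExp_cycleSum_sq_le (hw : IsNearlyIndependent w q δ)
    (hδ : 0 ≤ δ) (hq0 : 0 ≤ q) (hq1 : q ≤ 1) :
    weightExp w (fun g => cycleSum (centredEntry q g) ^ 2) ≤ n ^ 8 * δ + 32 * n ^ 6 := by
  have hcardF : (univ : Finset (Fin 4 → Fin n)).card = n ^ 4 := by simp
  have hexp : ∀ g : SimpleGraph (Fin n), cycleSum (centredEntry q g) ^ 2
      = ∑ t ∈ univ.filter (fun t : Fin 4 → Fin n => Function.Injective t),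
        ∑ t' ∈ univ.filter (fun t : Fin 4 → Fin n => Function.Injective t),
          cycleProd (centredEntry q g) t * cycleProd (centredEntry q g) t' := fun g => by
    rw [cycleSum, sq, sum_mul_sum]
  simp only [hexp, weightExp_sum]
  have hnn : ∀ (t t' : Fin 4 → Fin n), 0 ≤ ∑ c : Fin 4, ∑ d : Fin 4,
        if s(t c, t (c + 1)) = s(t' d, t' (d + 1)) then (1 : ℝ) else 0 := fun t t' =>
    sum_nonneg fun c _ => sum_nonneg fun d _ => by split_ifs <;> norm_num
  calc _ ≤ ∑ t ∈ univ.filter (fun t : Fin 4 → Fin n => Function.Injective t),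
        ∑ t' ∈ univ.filter (fun t : Fin 4 → Fin n => Function.Injective t),
          (δ + ∑ c : Fin 4, ∑ d : Fin 4,
            if s(t c, t (c + 1)) = s(t' d, t' (d + 1)) then (1 : ℝ) else 0) :=
        sum_le_sum fun t ht => sum_le_sum fun t' ht' => weightExp_cycleProd_mul_le hw hδ hq0 hq1
          (mem_filter.1 ht).2 (mem_filter.1 ht').2
    _ ≤ ∑ t : Fin 4 → Fin n, ∑ t' : Fin 4 → Fin n,
          (δ + ∑ c : Fin 4, ∑ d : Fin 4,
            if s(t c, t (c + 1)) = s(t' d, t' (d + 1)) then (1 : ℝ) else 0) := by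
        refine (sum_le_sum fun t _ => sum_le_sum_of_subset_of_nonneg (filter_subset _ _)
          fun t' _ _ => add_nonneg hδ (hnn t t')).trans ?_
        exact sum_le_sum_of_subset_of_nonneg (filter_subset _ _)
          fun t _ _ => sum_nonneg fun t' _ => add_nonneg hδ (hnn t t')
    _ ≤ ∑ t : Fin 4 → Fin n, (n ^ 4 * δ + 32 * n ^ 2) := by
        refine sum_le_sum fun t _ => ?_
        rw [sum_add_distrib, sum_const, hcardF, nsmul_eq_mul]
        push_cast
        gcongr
        rw [sum_comm]
        calc _ ≤ ∑ c : Fin 4, ∑ d : Fin 4, (2 * n ^ 2 : ℝ) := by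
              refine sum_le_sum fun c _ => ?_
              rw [sum_comm]
              refine sum_le_sum fun d _ => ?_
              rw [sum_boole]
              exact_mod_cast card_edge_eq_le d s(t c, t (c + 1))
          _ = _ := by simp; ring
    _ = _ := by rw [sum_const, hcardF, nsmul_eq_mul]; push_cast; ring

theorem weightExp_traceFour_sq_le (hw : IsNearlyIndependent w q δ)
    (hδ : 0 ≤ δ) (hq0 : 0 ≤ q) (hq1 : q ≤ 1) :
    weightExp w (fun g => traceFour (centredMat q g) ^ 2) ≤ 576 * n ^ 6 + 2 * (n ^ 8 * δ) := by
  refine (weightExp_mono hw fun g => traceFour_sq_le hq0 hq1 g).trans ?_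
  rw [weightExp_add, weightExp_const hw, weightExp_const_mul]
  linarith [weightExp_cycleSum_sq_le hw hδ hq0 hq1]

theorem weightExp_rowMean (hw : IsNearlyIndependent w q δ)
    (hn : 0 < n) : weightExp w (fun g => rowMean (centredMat q g)) = -q := by
  have hn' : (0 : ℝ) < n := by exact_mod_cast hn
  have h : ∀ i j : Fin n, weightExp w (fun g => centredMat q g i j) = if i = j then -q else 0 := by
    intro i j
    simp only [centredMat_apply]
    split_ifs with hij
    · simp only [centredEntry_of_isDiag q _ (Sym2.mk_isDiag_iff.2 hij), weightExp_const hw]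
    · exact hw.mean_eq_zero _ (by simpa using hij)
  simp only [rowMean, weightExp_div, weightExp_sum, h]
  simp
  field_simp

theorem abs_weightExp_mul_le (hw : IsNearlyIndependent w q δ)
    {e f : Sym2 (Fin n)} (he : ¬ e.IsDiag) (hf : ¬ f.IsDiag)
    (hef : e ≠ f) :
    |weightExp w (fun g => centredEntry q g e * centredEntry q g f)| ≤ δ := by
  have h := hw.abs_prod_le {e, f} (by simp [he, hf]) (by rw [card_pair hef])
    (by rw [card_pair hef]; norm_num)
  simpa only [prod_pair hef] using h

theorem weightExp_mul_self (hw : IsNearlyIndependent w q δ) {e : Sym2 (Fin n)} (he : ¬ e.IsDiag) :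
    weightExp w (fun g => centredEntry q g e * centredEntry q g e) = q * (1 - q) := by
  simp only [centredEntry_sq]
  rw [weightExp_add, weightExp_const hw, weightExp_const_mul, hw.mean_eq_zero e he]
  ring

theorem weightExp_mul_of_isDiag (hw : IsNearlyIndependent w q δ)
    {e f : Sym2 (Fin n)} (he : e.IsDiag) (hf : ¬ f.IsDiag) :
    weightExp w (fun g => centredEntry q g e * centredEntry q g f) = 0 := by
  simp only [centredEntry_of_isDiag q _ he]
  rw [weightExp_const_mul, hw.mean_eq_zero f hf, mul_zero]

theorem abs_weightExp_mul_le_one (hw : IsNearlyIndependent w q δ)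
    (hq0 : 0 ≤ q) (hq1 : q ≤ 1) (e f : Sym2 (Fin n)) :
    |weightExp w (fun g => centredEntry q g e * centredEntry q g f)| ≤ 1 := by
  refine (abs_weightExp_le hw _).trans ?_
  rw [← weightExp_const hw 1]
  refine weightExp_mono hw fun g => ?_
  rw [abs_mul]
  exact mul_le_one₀ (abs_centredEntry_le hq0 hq1 g e) (abs_nonneg _)
    (abs_centredEntry_le hq0 hq1 g f)

theorem abs_weightExp_mul_le_of_ne (hw : IsNearlyIndependent w q δ)
    (hδ : 0 ≤ δ) {e f : Sym2 (Fin n)}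
    (hdiag : ¬ (e.IsDiag ∧ f.IsDiag)) (hef : e ≠ f) :
    |weightExp w (fun g => centredEntry q g e * centredEntry q g f)| ≤ δ := by
  by_cases he : e.IsDiag
  · rw [weightExp_mul_of_isDiag hw he fun hf => hdiag ⟨he, hf⟩]; simpa
  · by_cases hf : f.IsDiag
    · simp only [mul_comm (centredEntry q _ e)]
      rw [weightExp_mul_of_isDiag hw hf he]; simpa
    · exact abs_weightExp_mul_le hw he hf hef

theorem abs_weightExp_sum_sq_sub_le (hw : IsNearlyIndependent w q δ)
    (hδ : 0 ≤ δ) (hq0 : 0 ≤ q) (hq1 : q ≤ 1) :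
    |weightExp w (fun g => ∑ i, (∑ j, centredMat q g i j) ^ 2) - n ^ 2 * (q * (1 - q))|
      ≤ n ^ 3 * δ + n := by
  have hterm : ∀ i j k : Fin n,
      |weightExp w (fun g => centredMat q g i j * centredMat q g i k)
          - if j = k then q * (1 - q) else 0| ≤ δ + if i = j ∧ j = k then 1 else 0 := by
    intro i j k
    simp only [centredMat_apply]
    by_cases hjk : j = k
    · subst hjk
      by_cases hij : i = j
      · subst hij
        simp only [centredEntry_of_isDiag q _ (Sym2.mk_isDiag_iff.2 rfl), weightExp_const hw,
          and_self, if_true]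
        rw [abs_le]
        constructor <;> nlinarith
      · rw [weightExp_mul_self hw (by simpa using hij)]
        simpa [hij] using hδ
    · simp only [hjk, if_false, sub_zero, and_false, add_zero]
      refine abs_weightExp_mul_le_of_ne hw hδ ?_ ?_
      · simp only [Sym2.mk_isDiag_iff]; rintro ⟨rfl, rfl⟩; exact hjk rfl
      · simp only [ne_eq, Sym2.congr_right]; exact hjk
  have hexp : weightExp w (fun g => ∑ i, (∑ j, centredMat q g i j) ^ 2) - n ^ 2 * (q * (1 - q))
      = ∑ i : Fin n, ∑ j : Fin n, ∑ k : Fin n,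
        (weightExp w (fun g => centredMat q g i j * centredMat q g i k)
          - if j = k then q * (1 - q) else 0) := by
    simp only [sq, Finset.sum_mul_sum, weightExp_sum, sum_sub_distrib]
    simp
    ring
  rw [hexp]
  calc _ ≤ ∑ i : Fin n, ∑ j : Fin n, ∑ k : Fin n,
        (δ + if i = j ∧ j = k then (1 : ℝ) else 0) :=
        (abs_sum_le_sum_abs _ _).trans <| sum_le_sum fun i _ =>
          (abs_sum_le_sum_abs _ _).trans <| sum_le_sum fun j _ =>
            (abs_sum_le_sum_abs _ _).trans <| sum_le_sum fun k _ => hterm i j k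
    _ = _ := by
        simp only [ite_and, sum_add_distrib]
        simp
        ring

theorem weightExp_rowMean_sq_le (hw : IsNearlyIndependent w q δ)
    (hn : 0 < n) (hδ : 0 ≤ δ) (hq0 : 0 ≤ q) (hq1 : q ≤ 1) :
    weightExp w (fun g => rowMean (centredMat q g) ^ 2) ≤ n ^ 2 * δ + 3 := by
  have hn' : (0 : ℝ) < n := by exact_mod_cast hn
  have hterm : ∀ i j k l : Fin n,
      weightExp w (fun g => centredMat q g i j * centredMat q g k l)
        ≤ δ + ((if i = k ∧ j = l then 1 else 0) + (if i = l ∧ j = k then 1 else 0)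
          + if i = j ∧ k = l then 1 else 0) := by
    intro i j k l
    simp only [centredMat_apply]
    have h0 : ∀ (P : Prop) [Decidable P], (0 : ℝ) ≤ if P then 1 else 0 := fun P _ => by
      split_ifs <;> norm_num
    by_cases hgen : (i = k ∧ j = l) ∨ (i = l ∧ j = k) ∨ (i = j ∧ k = l)
    · refine ((le_abs_self _).trans (abs_weightExp_mul_le_one hw hq0 hq1 _ _)).trans ?_
      have h1 := h0 (i = k ∧ j = l)
      have h2 := h0 (i = l ∧ j = k)
      have h3 := h0 (i = j ∧ k = l)
      rcases hgen with h | h | h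
      · rw [if_pos h]; linarith
      · rw [if_pos h]; linarith
      · rw [if_pos h]; linarith
    · push Not at hgen
      refine ((le_abs_self _).trans (abs_weightExp_mul_le_of_ne hw hδ ?_ ?_)).trans ?_
      · simp only [Sym2.mk_isDiag_iff]; exact fun h => hgen.2.2 h.1 h.2
      · simp only [ne_eq, Sym2.eq_iff]; tauto
      · linarith [h0 (i = k ∧ j = l), h0 (i = l ∧ j = k), h0 (i = j ∧ k = l)]
  have hexp : ∀ g : SimpleGraph (Fin n), rowMean (centredMat q g) ^ 2
      = (∑ i : Fin n, ∑ j : Fin n, ∑ k : Fin n, ∑ l : Fin n,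
        centredMat q g i j * centredMat q g k l) / (n : ℝ) ^ 2 := by
    intro g
    rw [rowMean, div_pow, sq (∑ i, ∑ j, centredMat q g i j)]
    simp only [Finset.sum_mul]
    simp only [Finset.mul_sum]
  simp only [hexp, weightExp_div, weightExp_sum]
  rw [div_le_iff₀ (by positivity)]
  calc _ ≤ ∑ i : Fin n, ∑ j : Fin n, ∑ k : Fin n, ∑ l : Fin n,
        (δ + ((if i = k ∧ j = l then 1 else 0) + (if i = l ∧ j = k then 1 else 0)
          + if i = j ∧ k = l then (1 : ℝ) else 0)) :=
        sum_le_sum fun i _ => sum_le_sum fun j _ => sum_le_sum fun k _ => sum_le_sum fun l _ =>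
          hterm i j k l
    _ = _ := by
        simp only [ite_and, sum_add_distrib]
        simp
        ring

theorem abs_weightExp_rowVar_sub_le (hw : IsNearlyIndependent w q δ)
    (hn : 0 < n) (hδ : 0 ≤ δ) (hq0 : 0 ≤ q) (hq1 : q ≤ 1) :
    |weightExp w (fun g => rowVar (centredMat q g)) - n * (q * (1 - q))|
      ≤ 2 * (n ^ 2 * δ) + 4 := by
  have hn' : (0 : ℝ) < n := by exact_mod_cast hn
  have h1 := abs_weightExp_sum_sq_sub_le hw hδ hq0 hq1
  have h2 := weightExp_rowMean_sq_le hw hn hδ hq0 hq1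
  have h3 : 0 ≤ weightExp w (fun g => rowMean (centredMat q g) ^ 2) := by
    rw [← weightExp_const hw 0]
    exact weightExp_mono hw fun g => sq_nonneg _
  simp only [rowVar, weightExp_sub, weightExp_div]
  set X := weightExp w fun g => ∑ i, (∑ j, centredMat q g i j) ^ 2
  have h4 : |X / n - n * (q * (1 - q))| ≤ n ^ 2 * δ + 1 := by
    have : X / n - n * (q * (1 - q)) = (X - n ^ 2 * (q * (1 - q))) / n := by field_simp
    rw [this, abs_div, abs_of_pos hn', div_le_iff₀ hn']
    linarith
  rw [abs_le] at h4 ⊢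
  constructor <;> linarith [h4.1, h4.2]

theorem abs_weightExp_lam1_sub_le (hw : IsNearlyIndependent w q δ)
    (hn : 0 < n) (hδ : 0 ≤ δ) (hq0 : 0 < q) (hq1 : q ≤ 1) {η : ℝ}
    (hη : 0 < η) (hη4 : η ≤ 1 / 4) :
    |weightExp w (fun g => lam1 (adjMat g)) - (q * n - q) - (1 - q)|
      ≤ 4 * η * (1 + (2 * (n ^ 2 * δ) + 4) / (q * n)) + (2 * (n ^ 2 * δ) + 4) / (q * n)
        + (n + n ^ 2 / (q * n)) * ((576 * n ^ 6 + 2 * (n ^ 8 * δ)) / (η * (q * n)) ^ 8) := by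
  have hn' : (0 : ℝ) < n := by exact_mod_cast hn
  set K := 2 * (n ^ 2 * δ) + 4
  set V := weightExp w fun g => rowVar (centredMat q g) with hV
  have hVar := abs_weightExp_rowVar_sub_le hw hn hδ hq0.le hq1
  have hVs : |V / (q * n) - (1 - q)| ≤ K / (q * n) := by
    have : V / (q * n) - (1 - q) = (V - n * (q * (1 - q))) / (q * n) := by field_simp
    rw [this, abs_div, abs_of_pos (show 0 < q * n by positivity)]
    gcongr
  have hmain : |weightExp w (fun g => lam1 (adjMat g)) - (q * n - q) - V / (q * n)|
      ≤ 4 * η * (V / (q * n)) + (n + n ^ 2 / (q * n))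
        * ((576 * n ^ 6 + 2 * (n ^ 8 * δ)) / (η * (q * n)) ^ 8) := by
    have h1 : weightExp w (fun g => lam1 (adjMat g)) - (q * n - q) - V / (q * n)
        = weightExp w (fun g => lam1 (adjMat g) - (q * n + rowMean (centredMat q g))
          - rowVar (centredMat q g) / (q * n)) := by
      rw [weightExp_sub, weightExp_sub, weightExp_add, weightExp_const hw,
        weightExp_rowMean hw hn, weightExp_div]
      ring
    rw [h1]
    refine (abs_weightExp_le hw _).trans
      ((weightExp_mono hw fun g => abs_lam1_adjMat_sub_le hn hq0 hq1 hη hη4 g).trans ?_)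
    rw [weightExp_add, weightExp_const_mul, weightExp_const_mul, weightExp_div, weightExp_div]
    gcongr
    exact weightExp_traceFour_sq_le hw hδ hq0.le hq1
  have hV1 : V / (q * n) ≤ 1 + K / (q * n) := by linarith [(abs_le.1 hVs).2]
  have h3 : 4 * η * (V / (q * n)) ≤ 4 * η * (1 + K / (q * n)) := by gcongr
  rw [abs_le] at hVs hmain ⊢
  constructor <;> linarith [hVs.1, hVs.2, hmain.1, hmain.2]

end weightExp

/-- The indicator of membership in a finite set, centred at `q`. -/
noncomputable def centredMem {α : Type*} (q : ℝ) (T : Finset α) (e : α) : ℝ :=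
  (if e ∈ T then 1 else 0) - q

theorem abs_centredMem_le {α : Type*} {q : ℝ} (hq0 : 0 ≤ q) (hq1 : q ≤ 1) (T : Finset α)
    (e : α) : |centredMem q T e| ≤ 1 := by
  unfold centredMem
  split_ifs <;> rw [abs_le] <;> constructor <;> linarith

theorem abs_prod_centredMem_le {α : Type*} {q : ℝ} (hq0 : 0 ≤ q) (hq1 : q ≤ 1) (T S : Finset α) :
    |∏ e ∈ S, centredMem q T e| ≤ 1 := by
  rw [abs_prod]
  exact prod_le_one (fun _ _ => abs_nonneg _) fun _ _ => abs_centredMem_le hq0 hq1 _ _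

/-- The joint moments of independent centred Bernoulli indicators. -/
theorem sum_powerset_prod_centredMem {α : Type*} [DecidableEq α] (q : ℝ) {U S : Finset α}
    (hS : S ⊆ U) :
    ∑ T ∈ U.powerset, q ^ T.card * (1 - q) ^ (U.card - T.card) * ∏ e ∈ S, centredMem q T e
      = if S = ∅ then 1 else 0 := by
  have h := Finset.prod_add (fun e => q * if e ∈ S then 1 - q else 1)
    (fun e => (1 - q) * if e ∈ S then -q else 1) U
  have hlhs : ∏ e ∈ U, (q * (if e ∈ S then 1 - q else 1) + (1 - q) * if e ∈ S then -q else 1)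
      = if S = ∅ then 1 else 0 := by
    split_ifs with h0
    · subst h0; simp
    · obtain ⟨e, he⟩ := nonempty_iff_ne_empty.2 h0
      refine prod_eq_zero (hS he) ?_
      rw [if_pos he, if_pos he]; ring
  rw [← hlhs, h]
  refine sum_congr rfl fun T hT => ?_
  rw [mem_powerset] at hT
  rw [prod_mul_distrib, prod_mul_distrib, prod_const, prod_const, card_sdiff_of_subset hT]
  have hprod : ∏ e ∈ S, centredMem q T e
      = (∏ e ∈ T, if e ∈ S then 1 - q else 1) * ∏ e ∈ U \ T, if e ∈ S then -q else 1 := by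
    have h1 : ∏ e ∈ S, centredMem q T e = ∏ e ∈ U, if e ∈ S then centredMem q T e else 1 := by
      rw [prod_ite_mem, inter_eq_right.2 hS]
    rw [h1, ← prod_sdiff hT, mul_comm]
    congr 1
    · exact prod_congr rfl fun e he => by simp [centredMem, he]
    · exact prod_congr rfl fun e he => by simp [centredMem, (mem_sdiff.1 he).2]
  rw [hprod]
  ring

theorem sum_powersetCard_swap {α : Type*} [DecidableEq α] (q : ℝ) {U S : Finset α} (L : ℕ)
    {e f : α} (he : e ∈ U) (hf : f ∈ U) (heS : e ∉ S) (hfS : f ∉ S) :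
    ∑ T ∈ U.powersetCard L, centredMem q T e * ∏ x ∈ S, centredMem q T x
      = ∑ T ∈ U.powersetCard L, centredMem q T f * ∏ x ∈ S, centredMem q T x := by
  have hU : ∀ x, x ∈ U → Equiv.swap e f x ∈ U := fun x hx => by
    rw [Equiv.swap_apply_def]; split_ifs <;> assumption
  have hmaps : ∀ T ∈ U.powersetCard L,
      T.map (Equiv.swap e f).toEmbedding ∈ U.powersetCard L := fun T hT => by
    rw [mem_powersetCard] at hT ⊢
    refine ⟨fun x hx => ?_, by simpa using hT.2⟩
    rw [mem_map_equiv, Equiv.symm_swap] at hx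
    simpa using hU _ (hT.1 hx)
  have hinv : ∀ T : Finset α, (T.map (Equiv.swap e f).toEmbedding).map
      (Equiv.swap e f).toEmbedding = T := fun T => by
    ext x; simp only [mem_map_equiv, Equiv.symm_swap, Equiv.swap_apply_self]
  refine sum_nbij' (fun T => T.map (Equiv.swap e f).toEmbedding)
    (fun T => T.map (Equiv.swap e f).toEmbedding) hmaps hmaps (fun T _ => hinv T)
    (fun T _ => hinv T) fun T _ => ?_
  have hmem : ∀ x, centredMem q (T.map (Equiv.swap e f).toEmbedding) x
      = centredMem q T (Equiv.swap e f x) := fun x => by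
    have h : x ∈ T.map (Equiv.swap e f).toEmbedding ↔ Equiv.swap e f x ∈ T := by
      rw [mem_map_equiv, Equiv.symm_swap]
    by_cases hx : Equiv.swap e f x ∈ T
    · simp only [centredMem, if_pos (h.2 hx), if_pos hx]
    · simp only [centredMem, if_neg (mt h.1 hx), if_neg hx]
  rw [hmem, Equiv.swap_apply_right]
  congr 1
  refine prod_congr rfl fun x hx => ?_
  rw [hmem, Equiv.swap_apply_of_ne_of_ne (ne_of_mem_of_not_mem hx heS)
    (ne_of_mem_of_not_mem hx hfS)]

/-- The joint moments of the centred indicators of a uniformly random subset of size `L`. -/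
theorem abs_sum_powersetCard_le {α : Type*} [DecidableEq α] {U S : Finset α} {L : ℕ}
    (hL : L ≤ U.card) (hU : 0 < U.card) (hS : S ⊆ U) {e : α} (he : e ∈ U) (heS : e ∉ S) :
    ((U.card : ℝ) - S.card) * |∑ T ∈ U.powersetCard L,
        centredMem ((L : ℝ) / U.card) T e * ∏ x ∈ S, centredMem ((L : ℝ) / U.card) T x|
      ≤ S.card * (U.powersetCard L).card := by
  have hU' : (0 : ℝ) < U.card := by exact_mod_cast hU
  set q : ℝ := (L : ℝ) / U.card with hq
  have hq0 : 0 ≤ q := by positivity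
  have hq1 : q ≤ 1 := by rw [hq, div_le_one hU']; exact_mod_cast hL
  set G : α → ℝ := fun f => ∑ T ∈ U.powersetCard L,
    centredMem q T f * ∏ x ∈ S, centredMem q T x with hG
  have hGbound : ∀ f, |G f| ≤ (U.powersetCard L).card := fun f => by
    calc |G f| ≤ ∑ T ∈ U.powersetCard L, (1 : ℝ) :=
          (abs_sum_le_sum_abs _ _).trans <| sum_le_sum fun T _ => by
            rw [abs_mul]
            exact mul_le_one₀ (abs_centredMem_le hq0 hq1 _ _) (abs_nonneg _)
              (abs_prod_centredMem_le hq0 hq1 _ _)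
      _ = _ := by rw [sum_const, nsmul_eq_mul, mul_one]
  have htotal : ∑ f ∈ U, G f = 0 := by
    rw [hG, sum_comm]
    refine sum_eq_zero fun T hT => ?_
    rw [mem_powersetCard] at hT
    rw [← Finset.sum_mul]
    have : ∑ f ∈ U, centredMem q T f = 0 := by
      have h1 : ∑ f ∈ U, (if f ∈ T then (1 : ℝ) else 0) = L := by
        rw [sum_ite_mem, inter_eq_right.2 hT.1, sum_const, nsmul_eq_mul, mul_one, hT.2]
      have h2 : ∑ f ∈ U, centredMem q T f = ∑ f ∈ U, ((if f ∈ T then (1 : ℝ) else 0) - q) :=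
        sum_congr rfl fun f _ => by simp [centredMem]
      rw [h2, sum_sub_distrib, h1, sum_const, nsmul_eq_mul, hq, mul_div_cancel₀ _ hU'.ne',
        sub_self]
    rw [this, zero_mul]
  have hconst : ∑ f ∈ U \ S, G f = ((U.card : ℝ) - S.card) * G e := by
    rw [sum_congr rfl fun f hf => sum_powersetCard_swap q L (mem_sdiff.1 hf).1 he
      (mem_sdiff.1 hf).2 heS, sum_const, card_sdiff_of_subset hS, nsmul_eq_mul,
      Nat.cast_sub (card_le_card hS)]
  have hsplit := sum_sdiff (f := G) hS
  rw [htotal, hconst] at hsplit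
  have hcard : (S.card : ℝ) ≤ U.card := by exact_mod_cast card_le_card hS
  calc ((U.card : ℝ) - S.card) * |G e| = |((U.card : ℝ) - S.card) * G e| := by
        rw [abs_mul, abs_of_nonneg (sub_nonneg.2 hcard)]
    _ = |∑ f ∈ S, G f| := by rw [eq_neg_of_add_eq_zero_left hsplit, abs_neg]
    _ ≤ ∑ f ∈ S, ((U.powersetCard L).card : ℝ) :=
        (abs_sum_le_sum_abs _ _).trans (sum_le_sum fun f _ => hGbound f)
    _ = _ := by rw [sum_const, nsmul_eq_mul]

/-- The set of possible edges of a graph on `Fin n`. -/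
def possibleEdges (n : ℕ) : Finset (Sym2 (Fin n)) := univ.filter fun e => ¬ e.IsDiag

theorem card_possibleEdges (n : ℕ) : (possibleEdges n).card = n.choose 2 := by
  rw [possibleEdges, ← Fintype.card_subtype, Sym2.card_subtype_not_diag, Fintype.card_fin]

theorem sum_edgeFinset {n : ℕ} (F : Finset (Sym2 (Fin n)) → ℝ) :
    ∑ g : SimpleGraph (Fin n), F g.edgeFinset = ∑ T ∈ (possibleEdges n).powerset, F T := by
  refine sum_bij' (fun g _ => g.edgeFinset) (fun T _ => SimpleGraph.fromEdgeSet (T : Set _))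
    ?_ (fun _ _ => mem_univ _) ?_ ?_ fun _ _ => rfl
  · intro g _
    rw [mem_powerset]
    intro e he
    rw [SimpleGraph.mem_edgeFinset] at he
    simpa [possibleEdges] using g.not_isDiag_of_mem_edgeSet he
  · intro g _
    simp
  · intro T hT
    rw [mem_powerset] at hT
    ext e
    simp only [SimpleGraph.mem_edgeFinset, SimpleGraph.edgeSet_fromEdgeSet, Set.mem_sdiff,
      mem_coe, and_iff_left_iff_imp]
    intro he
    simpa [possibleEdges] using hT he

theorem centredEntry_eq_centredMem {n : ℕ} (q : ℝ) (g : SimpleGraph (Fin n))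
    (e : Sym2 (Fin n)) : centredEntry q g e = centredMem q g.edgeFinset e := by
  simp only [centredEntry, centredMem, SimpleGraph.mem_edgeFinset]

theorem weightExp_erWeight {n : ℕ} (q : ℝ) {S : Finset (Sym2 (Fin n))}
    (hS : ∀ e ∈ S, ¬ e.IsDiag) :
    weightExp (erWeight n q) (fun g => ∏ e ∈ S, centredEntry q g e) = if S = ∅ then 1 else 0 := by
  have hSU : S ⊆ possibleEdges n := fun e he => by simpa [possibleEdges] using hS e he
  rw [← sum_powerset_prod_centredMem q hSU, ← sum_edgeFinset]
  simp only [weightExp, erWeight, edgeCount, centredEntry_eq_centredMem, card_possibleEdges]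

theorem isNearlyIndependent_erWeight {n : ℕ} {q δ : ℝ} (hq0 : 0 ≤ q) (hq1 : q ≤ 1) (hδ : 0 ≤ δ) :
    IsNearlyIndependent (erWeight n q) q δ where
  nonneg g := mul_nonneg (pow_nonneg hq0 _) (pow_nonneg (by linarith) _)
  sum_eq_one := by
    simpa [weightExp] using weightExp_erWeight q (S := (∅ : Finset (Sym2 (Fin n)))) (by simp)
  mean_eq_zero e he := by
    simpa using weightExp_erWeight q (S := {e}) (by simpa using he)
  abs_prod_le S hS h2 _ := by
    have h0 : S ≠ ∅ := by rintro rfl; simp at h2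
    rw [weightExp_erWeight q hS, if_neg h0, abs_zero]
    exact hδ

/-- The weight of the uniform distribution on graphs with `L` edges. -/
noncomputable def micWeight (n L : ℕ) (g : SimpleGraph (Fin n)) : ℝ :=
  if edgeCount g = L then ((((possibleEdges n).powersetCard L).card : ℝ))⁻¹ else 0

theorem weightExp_micWeight {n : ℕ} (L : ℕ) (F : Finset (Sym2 (Fin n)) → ℝ) :
    weightExp (micWeight n L) (fun g => F g.edgeFinset)
      = (∑ T ∈ (possibleEdges n).powersetCard L, F T)
        / ((possibleEdges n).powersetCard L).card := by
  have h := sum_edgeFinset (n := n) fun T =>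
    (if T.card = L then ((((possibleEdges n).powersetCard L).card : ℝ))⁻¹ else 0) * F T
  refine Eq.trans h ?_
  rw [powersetCard_eq_filter, Finset.sum_div, sum_filter]
  refine sum_congr rfl fun T _ => ?_
  split_ifs
  · rw [div_eq_inv_mul]
  · rw [zero_mul]

theorem micExp_eq_weightExp {n : ℕ} (L : ℕ) (f : SimpleGraph (Fin n) → ℝ) :
    micExp (univ.filter fun g : SimpleGraph (Fin n) => edgeCount g = L) f
      = weightExp (micWeight n L) f := by
  have hcard : ((univ.filter fun g : SimpleGraph (Fin n) => edgeCount g = L).card : ℝ)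
      = ((possibleEdges n).powersetCard L).card := by
    have h := sum_edgeFinset (n := n) fun T => if T.card = L then (1 : ℝ) else 0
    rw [sum_boole, sum_boole, ← powersetCard_eq_filter] at h
    exact h
  rw [micExp, hcard, weightExp, Finset.sum_div, sum_filter]
  refine sum_congr rfl fun g _ => ?_
  unfold micWeight
  split_ifs
  · rw [div_eq_inv_mul]
  · rw [zero_mul]

theorem isNearlyIndependent_micWeight {n L : ℕ} (hn : 8 ≤ n) (hL : L ≤ n.choose 2) :
    IsNearlyIndependent (micWeight n L) ((L : ℝ) / n.choose 2) (56 / n ^ 2) := by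
  have hn' : (8 : ℝ) ≤ n := by exact_mod_cast hn
  have hchoose : ((n.choose 2 : ℕ) : ℝ) = n * (n - 1) / 2 := Nat.cast_choose_two ℝ n
  have hNR : (n : ℝ) ^ 2 / 8 ≤ (n.choose 2 : ℝ) - 7 := by rw [hchoose]; nlinarith
  have hNpos : 0 < (possibleEdges n).card := by
    rw [card_possibleEdges]; exact Nat.choose_pos (by omega)
  have hLU : L ≤ (possibleEdges n).card := by rwa [card_possibleEdges]
  have hMpos : (0 : ℝ) < ((possibleEdges n).powersetCard L).card := by
    rw [card_powersetCard]; exact_mod_cast Nat.choose_pos hLU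
  set q : ℝ := (L : ℝ) / n.choose 2 with hq
  have hmoment : ∀ S : Finset (Sym2 (Fin n)), (∀ f ∈ S, ¬ f.IsDiag) → ∀ e, ¬ e.IsDiag → e ∉ S →
      ((n.choose 2 : ℝ) - S.card) * |weightExp (micWeight n L)
        (fun g => centredEntry q g e * ∏ f ∈ S, centredEntry q g f)| ≤ S.card := by
    intro S hS e he heS
    have h := abs_sum_powersetCard_le (U := possibleEdges n) (S := S) hLU hNpos
      (fun f hf => by simpa [possibleEdges] using hS f hf)
      (e := e) (by simpa [possibleEdges] using he) heS
    rw [card_possibleEdges, ← hq] at h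
    simp only [centredEntry_eq_centredMem]
    rw [weightExp_micWeight L fun T => centredMem q T e * ∏ f ∈ S, centredMem q T f, abs_div,
      abs_of_pos hMpos, ← mul_div_assoc, div_le_iff₀ hMpos]
    exact h
  refine ⟨fun g => ?_, ?_, fun e he => ?_, fun S hS h2 h8 => ?_⟩
  · unfold micWeight; split_ifs <;> positivity
  · have h := weightExp_micWeight (n := n) L fun _ => 1
    simp only [mul_one, sum_const, nsmul_eq_mul] at h
    simpa only [weightExp, mul_one, div_self hMpos.ne'] using h
  · have h := hmoment ∅ (by simp) e he (by simp)
    simp only [card_empty, Nat.cast_zero, sub_zero, prod_empty, mul_one] at h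
    have hc : (0 : ℝ) < n.choose 2 := by nlinarith
    exact abs_nonpos_iff.1 (nonpos_of_mul_nonpos_right h hc)
  · obtain ⟨e, he⟩ : S.Nonempty := card_pos.1 (by omega)
    have h := hmoment (S.erase e) (fun f hf => hS f (mem_of_mem_erase hf)) e (hS e he)
      (notMem_erase e S)
    simp only [mul_prod_erase S _ he] at h
    have hc : (((S.erase e).card : ℕ) : ℝ) ≤ 7 := by
      rw [card_erase_of_mem he]; exact_mod_cast (by omega : S.card - 1 ≤ 7)
    rw [le_div_iff₀ (by positivity)]
    set X := |weightExp (micWeight n L) fun g => ∏ e ∈ S, centredEntry q g e|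
    have hX : 0 ≤ X := abs_nonneg _
    have h1 : (n : ℝ) ^ 2 / 8 * X ≤ ((n.choose 2 : ℝ) - (S.erase e).card) * X :=
      mul_le_mul_of_nonneg_right (by linarith) hX
    linarith

theorem IsNearlyIndependent.abs_weightExp_lam1_sub_le {n : ℕ} (hn : 0 < n)
    {w : SimpleGraph (Fin n) → ℝ} {q : ℝ} (hw : IsNearlyIndependent w q (56 / n ^ 2))
    (hq0 : 0 < q) (hq1 : q ≤ 1) {η : ℝ} (hη : 0 < η) (hη4 : η ≤ 1 / 4) :
    |weightExp w (fun g => lam1 (adjMat g)) - (q * n - q) - (1 - q)|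
      ≤ 4 * η + ((4 * η + 1) * 116 / q + (1 + 1 / q) * 688 / (η * q) ^ 8) * (1 / n) := by
  have hn' : (0 : ℝ) < n := by exact_mod_cast hn
  refine (_root_.abs_weightExp_lam1_sub_le hw hn (by positivity) hq0 hq1 hη hη4).trans
    (le_of_eq ?_)
  field_simp
  ring

/-- Ensemble equivalence for the largest eigenvalue under a constraint on the total
number of edges.  Fix `p ∈ (0,1)`; for each `n` let `L n ≤ C(n,2)` with
`L n / C(n,2) → p`.  Let the microcanonical ensemble be uniform on graphs with
exactly `L n` edges, and the canonical ensemble be `G(n, L n / C(n,2))`.  Then the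
difference of the expected largest adjacency eigenvalues tends to `0`. -/
theorem edge_constraint_eigenvalue_ensemble_equivalence
    (p : ℝ) (hp : p ∈ Set.Ioo (0 : ℝ) 1)
    (L : ℕ → ℕ) (hL : ∀ n, 2 ≤ n → L n ≤ n.choose 2)
    (hlim : Filter.Tendsto (fun n => (L n : ℝ) / (n.choose 2 : ℝ))
      Filter.atTop (nhds p)) :
    Filter.Tendsto
      (fun n =>
        erExp n ((L n : ℝ) / (n.choose 2 : ℝ)) (fun g => lam1 (adjMat g))
          - micExp (Finset.univ.filter fun g : SimpleGraph (Fin n) => edgeCount g = L n)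
              (fun g => lam1 (adjMat g)))
      Filter.atTop (nhds 0) := by

  have hq : ∀ᶠ n in Filter.atTop, 0 < (L n : ℝ) / (n.choose 2 : ℝ) :=
    hlim.eventually (lt_mem_nhds hp.1)
  rw [Metric.tendsto_nhds]
  intro ε hε
  obtain ⟨η, hη, hη4, hηε⟩ : ∃ η : ℝ, 0 < η ∧ η ≤ 1 / 4 ∧ 4 * η < ε / 2 :=
    ⟨min (1 / 4) (ε / 16), by positivity, min_le_left _ _,
      by linarith [min_le_right (1 / 4) (ε / 16)]⟩
  have hbound : Filter.Tendsto (fun n : ℕ => 4 * η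
      + ((4 * η + 1) * 116 / ((L n : ℝ) / (n.choose 2 : ℝ))
        + (1 + 1 / ((L n : ℝ) / (n.choose 2 : ℝ))) * 688
          / (η * ((L n : ℝ) / (n.choose 2 : ℝ))) ^ 8) * (1 / (n : ℝ)))
      Filter.atTop (nhds (4 * η
      + ((4 * η + 1) * 116 / p + (1 + 1 / p) * 688 / (η * p) ^ 8) * 0)) := by
    have hp0 : p ≠ 0 := hp.1.ne'
    refine tendsto_const_nhds.add (Filter.Tendsto.mul (Filter.Tendsto.add ?_ ?_)
      tendsto_one_div_atTop_nhds_zero_nat)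
    · exact tendsto_const_nhds.div hlim hp0
    · exact ((tendsto_const_nhds.add (tendsto_const_nhds.div hlim hp0)).mul
        tendsto_const_nhds).div ((tendsto_const_nhds.mul hlim).pow 8)
        (pow_ne_zero _ (mul_ne_zero hη.ne' hp0))
  rw [mul_zero, add_zero] at hbound
  filter_upwards [hq, hbound.eventually (gt_mem_nhds hηε), Filter.eventually_ge_atTop 8]
    with n hqn hbn hn
  have hLn : L n ≤ n.choose 2 := hL n (by omega)
  have hN : (0 : ℝ) < n.choose 2 := by exact_mod_cast Nat.choose_pos (by omega)
  have hq1 : (L n : ℝ) / (n.choose 2 : ℝ) ≤ 1 := by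
    rw [div_le_one hN]; exact_mod_cast hLn
  have hcan := (isNearlyIndependent_erWeight (n := n) (δ := 56 / (n : ℝ) ^ 2) hqn.le hq1
    (by positivity)).abs_weightExp_lam1_sub_le (by omega) hqn hq1 hη hη4
  have hmic := (isNearlyIndependent_micWeight hn hLn).abs_weightExp_lam1_sub_le (by omega) hqn hq1
    hη hη4
  rw [micExp_eq_weightExp, Real.dist_eq, sub_zero]
  change |weightExp (erWeight n _) _ - _| < ε
  have hcan' := abs_le.1 (hcan.trans hbn.le)
  have hmic' := abs_lt.1 (hmic.trans_lt hbn)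
  rw [abs_lt]
  constructor <;> linarith [hcan'.1, hcan'.2, hmic'.1, hmic'.2]
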